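/- arXiv:2404.13952 — 2 statements merged into one kernel-verified Lean document; each statement's English description precedes it below -/
import Mathlib

section
/- The four lattices L₁ = {(x,y) ∈ ℤ² : y ≡ 0 (mod 2)}, L₂ = {(x,y) ∈ ℤ² : x ≡ 0 (mod 2)}, L₃ = {(x,y) ∈ ℤ² : 3x + y ≡ 0 (mod 4)}, and L₄ = {(x,y) ∈ ℤ² : x + y ≡ 0 (mod 4)} (generated respectively by (1,0),(0,2); (2,0),(0,1); (1,1),(0,4); and (1,3),(0,4)) form a minimal covering of ℤ². -/
/-- The sublattice of ℤ² defined by the congruence `a·x₁ + b·x₂ ≡ 0 (mod n)`. -/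
def congLat (a b n : ℤ) : AddSubgroup (ℤ × ℤ) where
  carrier := {p : ℤ × ℤ | n ∣ a * p.1 + b * p.2}
  zero_mem' := by simp
  add_mem' := by
    intro p q hp hq
    simp only [Set.mem_setOf_eq, Prod.fst_add, Prod.snd_add] at *
    have e : a * (p.1 + q.1) + b * (p.2 + q.2)
        = (a * p.1 + b * p.2) + (a * q.1 + b * q.2) := by ring
    rw [e]; exact dvd_add hp hq
  neg_mem' := by
    intro p hp
    simp only [Set.mem_setOf_eq, Prod.fst_neg, Prod.snd_neg] at *
    have e : a * (-p.1) + b * (-p.2) = -(a * p.1 + b * p.2) := by ring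
    rw [e]; exact hp.neg_right

/-- A lattice: a finite-index (equivalently, rank-2) subgroup of ℤ². -/
def IsLattice (L : AddSubgroup (ℤ × ℤ)) : Prop := L.index ≠ 0

/-- A finite family of lattices covering ℤ². -/
def IsCovering {k : ℕ} (L : Fin k → AddSubgroup (ℤ × ℤ)) : Prop :=
  (∀ i, IsLattice (L i)) ∧ ∀ p : ℤ × ℤ, ∃ i, p ∈ L i

/-- A minimal covering of ℤ² by lattices: replacing any member by a proper
sublattice destroys the covering property. -/
def IsMinimalCovering {k : ℕ} (L : Fin k → AddSubgroup (ℤ × ℤ)) : Prop :=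
  IsCovering L ∧ ∀ (i : Fin k) (L' : AddSubgroup (ℤ × ℤ)),
    IsLattice L' → L' < L i → ¬ IsCovering (Function.update L i L')

theorem mem_congLat (a b n : ℤ) (p : ℤ × ℤ) : p ∈ congLat a b n ↔ n ∣ a * p.1 + b * p.2 :=
  Iff.rfl

theorem isLattice_congLat (a b : ℤ) (n : ℕ) (hn : n ≠ 0) : IsLattice (congLat a b n) := by
  have : NeZero n := ⟨hn⟩
  let f : ℤ × ℤ →+ ZMod n :=
    { toFun := fun p => ((a * p.1 + b * p.2 : ℤ) : ZMod n)
      map_zero' := by simp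
      map_add' := by
        intro p q
        simp only [Prod.fst_add, Prod.snd_add]
        push_cast
        ring }
  have e : congLat a b n = f.ker := by
    ext p
    rw [mem_congLat, AddMonoidHom.mem_ker]
    exact (ZMod.intCast_zmod_eq_zero_iff_dvd _ _).symm
  unfold IsLattice
  rw [e, AddSubgroup.index_ker]
  exact Nat.card_pos.ne.symm

/-- If `M` contains every point of `L` satisfying `U`, and each point of `L` either satisfies `U`
or does so after subtracting a fixed `e ∈ L` with `U e`, then `L ≤ M`. -/
theorem le_of_unique (L M : AddSubgroup (ℤ × ℤ)) (U : ℤ × ℤ → Prop) (e : ℤ × ℤ)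
    (he : e ∈ L) (hU : U e) (h : ∀ p ∈ L, U p → p ∈ M)
    (hs : ∀ p ∈ L, ¬ U p → U (p - e)) : L ≤ M := by
  intro p hp
  by_cases hu : U p
  · exact h p hp hu
  · have h1 := h _ (L.sub_mem hp he) (hs p hp hu)
    simpa using M.add_mem h1 (h e he hU)

/-- The four lattices `{y ≡ 0 (2)}`, `{x ≡ 0 (2)}`, `{3x + y ≡ 0 (4)}`, `{x + y ≡ 0 (4)}`
form a minimal covering of ℤ². -/
theorem minimal_covering_stmt :
    IsMinimalCovering ![congLat 0 1 2, congLat 1 0 2, congLat 3 1 4, congLat 1 1 4] := by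
  refine ⟨⟨?_, ?_⟩, ?_⟩
  · intro i
    fin_cases i
    · exact isLattice_congLat 0 1 2 (by norm_num)
    · exact isLattice_congLat 1 0 2 (by norm_num)
    · exact isLattice_congLat 3 1 4 (by norm_num)
    · exact isLattice_congLat 1 1 4 (by norm_num)
  · intro p
    simp only [Fin.exists_fin_succ, Fin.exists_fin_zero]
    simp [mem_congLat]
    omega
  · intro i M _ hlt hc
    apply hlt.not_ge
    have hcov := hc.2
    simp only [Fin.exists_fin_succ, Fin.exists_fin_zero] at hcov
    fin_cases i
    · refine le_of_unique _ _ (fun p => p.1 % 2 = 1) (1, 0) ?_ ?_ ?_ ?_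
      · simp [mem_congLat]
      · simp
      · intro p hp hu
        have := hcov p
        simp [mem_congLat, Function.update] at this hp
        grind
      · intro p hp hu
        simp at hu ⊢
        omega
    · refine le_of_unique _ _ (fun p => p.2 % 2 = 1) (0, 1) ?_ ?_ ?_ ?_
      · simp [mem_congLat]
      · simp
      · intro p hp hu
        have := hcov p
        simp [mem_congLat, Function.update] at this hp
        grind
      · intro p hp hu
        simp at hu ⊢
        omega
    · refine le_of_unique _ _ (fun p => p.1 % 2 = 1) (1, 1) ?_ ?_ ?_ ?_
      · simp [mem_congLat]
      · simp
      · intro p hp hu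
        have := hcov p
        simp [mem_congLat, Function.update] at this hp
        grind
      · intro p hp hu
        simp at hu ⊢
        omega
    · refine le_of_unique _ _ (fun p => p.1 % 2 = 1) (1, -1) ?_ ?_ ?_ ?_
      · simp [mem_congLat]
      · simp
      · intro p hp hu
        have := hcov p
        simp [mem_congLat, Function.update] at this hp
        grind
      · intro p hp hu
        simp at hu ⊢
        omega
end

section
/- Let D and ν be positive integers with D | ν, 1 ≤ ν ≤ D², Dν > 1, and D ∈ {2,4}, and let t₁,t₂,t₃,t₄ be integers with gcd(t₁,t₂,t₃,t₄) = 1 and d₂ := |t₁t₄ − t₂t₃| ≠ 0. Define the four subgroups of ℤ²: Λ₀ := {(x₁,x₂) : x₁ ≡ 0 (mod D) and νx₂ ≡ 0 (mod D)}; Λ₁ := {(x₁,x₂) : (t₁t₂+t₃t₄)x₁ + (t₂²+t₄²)x₂ ≡ 0 (mod d₂D) and ν((t₁²+t₃²)x₁ + (t₁t₂+t₃t₄)x₂) ≡ 0 (mod d₂D)}; Λ₂ := {(x₁,x₂) : (t₃t₄−t₁t₂)x₁ + (t₄²−t₂²)x₂ ≡ 0 (mod d₂D) and ν((t₁²−t₃²)x₁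 + (t₁t₂−t₃t₄)x₂) ≡ 0 (mod d₂D)}; Λ₃ := {(x₁,x₂) : (t₂t₃+t₁t₄)x₁ + 2t₂t₄x₂ ≡ 0 (mod d₂D) and ν(2t₁t₃x₁ + (t₂t₃+t₁t₄)x₂) ≡ 0 (mod d₂D)}. If Λ₀ ∪ Λ₁ ∪ Λ₂ ∪ Λ₃ = ℤ² and Λᵢ ≠ ℤ² for all i ∈ {0,1,2,3}, then there exists i ∈ {1,2,3} with [ℤ² : Λᵢ] = 2. -/
/-- `Λ₀ = {(x₁,x₂) : x₁ ≡ 0 (mod D), ν·x₂ ≡ 0 (mod D)}`. -/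
def Lam0 (D ν : ℤ) : AddSubgroup (ℤ × ℤ) := congLat 1 0 D ⊓ congLat 0 ν D

/-- `Λ₁`, cut out by `(t₁t₂+t₃t₄)x₁ + (t₂²+t₄²)x₂ ≡ 0` and
`ν((t₁²+t₃²)x₁ + (t₁t₂+t₃t₄)x₂) ≡ 0 (mod d₂D)`, where `d₂ = |t₁t₄ - t₂t₃|`. -/
def Lam1 (D ν t1 t2 t3 t4 : ℤ) : AddSubgroup (ℤ × ℤ) :=
  congLat (t1 * t2 + t3 * t4) (t2 ^ 2 + t4 ^ 2) (|t1 * t4 - t2 * t3| * D) ⊓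
    congLat (ν * (t1 ^ 2 + t3 ^ 2)) (ν * (t1 * t2 + t3 * t4)) (|t1 * t4 - t2 * t3| * D)

/-- `Λ₂`, cut out by `(t₃t₄-t₁t₂)x₁ + (t₄²-t₂²)x₂ ≡ 0` and
`ν((t₁²-t₃²)x₁ + (t₁t₂-t₃t₄)x₂) ≡ 0 (mod d₂D)`. -/
def Lam2 (D ν t1 t2 t3 t4 : ℤ) : AddSubgroup (ℤ × ℤ) :=
  congLat (t3 * t4 - t1 * t2) (t4 ^ 2 - t2 ^ 2) (|t1 * t4 - t2 * t3| * D) ⊓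
    congLat (ν * (t1 ^ 2 - t3 ^ 2)) (ν * (t1 * t2 - t3 * t4)) (|t1 * t4 - t2 * t3| * D)

/-- `Λ₃`, cut out by `(t₂t₃+t₁t₄)x₁ + 2t₂t₄x₂ ≡ 0` and
`ν(2t₁t₃x₁ + (t₂t₃+t₁t₄)x₂) ≡ 0 (mod d₂D)`. -/
def Lam3 (D ν t1 t2 t3 t4 : ℤ) : AddSubgroup (ℤ × ℤ) :=
  congLat (t2 * t3 + t1 * t4) (2 * t2 * t4) (|t1 * t4 - t2 * t3| * D) ⊓
    congLat (ν * (2 * t1 * t3)) (ν * (t2 * t3 + t1 * t4)) (|t1 * t4 - t2 * t3| * D)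

open scoped Pointwise

/-- Points of `ℤ²` with even first coordinate. -/
def evenLat : AddSubgroup (ℤ × ℤ) := congLat 1 0 2

theorem mem_evenLat (p : ℤ × ℤ) : p ∈ evenLat ↔ (2 : ℤ) ∣ p.1 := by
  change (2 : ℤ) ∣ 1 * p.1 + 0 * p.2 ↔ _
  simp

theorem odd_sub_mem {p c : ℤ × ℤ} (hp : p ∉ evenLat) (hc : c ∉ evenLat) : -c + p ∈ evenLat := by
  rw [mem_evenLat] at *
  simp only [Prod.fst_add, Prod.fst_neg]
  omega

/-- The part of a proper subgroup of index other than 2 outside `evenLat` has density at most 1/6. -/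
theorem odd_part (L : AddSubgroup (ℤ × ℤ)) (h1 : L ≠ ⊤) (h2 : L.index ≠ 2) :
    ∃ (g : ℤ × ℤ) (K : AddSubgroup (ℤ × ℤ)), ((K.index : ℚ)⁻¹ ≤ 1 / 6) ∧
      ((K.index : ℚ)⁻¹ = 1 / 6 → L.index = 3) ∧
      ∀ p ∈ L, p ∉ evenLat → p ∈ g +ᵥ (K : Set (ℤ × ℤ)) := by
  by_cases h : L ≤ evenLat
  · refine ⟨0, ⊥, ?_, ?_, fun p hp hn => absurd (h hp) hn⟩ <;>
      simp [AddSubgroup.index_bot]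
  · obtain ⟨c, hc, hce⟩ := SetLike.not_le_iff_exists.mp h
    have hr : evenLat.relIndex L ≠ 1 := fun e => h (AddSubgroup.relIndex_eq_one.mp e)
    have hm : L.index ≠ 1 := fun e => h1 (AddSubgroup.index_eq_one.mp e)
    have hi : evenLat.relIndex L * L.index = (L ⊓ evenLat).index := by
      rw [← AddSubgroup.relIndex_mul_index (inf_le_left : L ⊓ evenLat ≤ L),
        AddSubgroup.inf_relIndex_left]
    refine ⟨c, L ⊓ evenLat, ?_, ?_, ?_⟩
    · rw [← hi]
      generalize evenLat.relIndex L = r at *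
      generalize L.index = m at *
      rcases Nat.eq_zero_or_pos r with rfl | hr0
      · simp
      rcases Nat.eq_zero_or_pos m with rfl | hm0
      · simp
      have : 6 ≤ r * m := Nat.mul_le_mul (show 2 ≤ r by omega) (show 3 ≤ m by omega)
      have h6 : (6 : ℚ) ≤ ((r * m : ℕ) : ℚ) := by exact_mod_cast this
      rw [one_div]
      exact inv_anti₀ (by norm_num) h6
    · rw [← hi, one_div, inv_inj]
      intro h6
      have h6' : evenLat.relIndex L * L.index = 6 := by exact_mod_cast h6
      generalize evenLat.relIndex L = r at *
      generalize L.index = m at *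
      have hm0 : m ≠ 0 := by rintro rfl; simp at h6'
      have hr0 : r ≠ 0 := by rintro rfl; simp at h6'
      have h3 : 3 ≤ m := by omega
      have h2r : 2 ≤ r := by omega
      nlinarith
    · intro p hp hpe
      rw [mem_leftAddCoset_iff]
      exact ⟨L.add_mem (L.neg_mem hc) hp, odd_sub_mem hpe hce⟩

theorem cover_odd (L : Fin 3 → AddSubgroup (ℤ × ℤ)) (h1 : ∀ i, L i ≠ ⊤)
    (h2 : ∀ i, (L i).index ≠ 2) (hc : ∀ p, p ∉ evenLat → ∃ i, p ∈ L i) : False := by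
  choose g K hle heq hmem using fun i => odd_part (L i) (h1 i) (h2 i)
  have hE : ((evenLat.index : ℚ))⁻¹ ≤ 1 / 2 := by
    have : evenLat.index ≠ 1 := fun e => by
      have h := AddSubgroup.index_eq_one.mp e
      have h' : ((1, 0) : ℤ × ℤ) ∈ evenLat := h ▸ AddSubgroup.mem_top _
      rw [mem_evenLat] at h'
      norm_num at h'
    rcases Nat.eq_zero_or_pos evenLat.index with h | h
    · simp [h]
    · have h2 : (2 : ℚ) ≤ (evenLat.index : ℚ) := by exact_mod_cast (by omega : 2 ≤ evenLat.index)
      rw [one_div]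
      exact inv_anti₀ (by norm_num) h2
  have hcov : ⋃ i ∈ (Finset.univ : Finset (Fin 4)),
      (Fin.cons 0 g : Fin 4 → ℤ × ℤ) i +ᵥ
        ((Fin.cons evenLat K : Fin 4 → AddSubgroup (ℤ × ℤ)) i : Set (ℤ × ℤ)) = Set.univ := by
    refine Set.eq_univ_of_forall fun p => ?_
    simp only [Finset.mem_univ, Set.iUnion_true, Set.mem_iUnion]
    by_cases hp : p ∈ evenLat
    · exact ⟨0, by simpa using hp⟩
    · obtain ⟨i, hi⟩ := hc p hp
      exact ⟨i.succ, by simpa using hmem i p hi hp⟩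
  have hs := AddSubgroup.one_le_sum_inv_index_of_leftCoset_cover hcov
  rw [Fin.sum_univ_succ] at hs
  simp only [Fin.cons_zero, Fin.cons_succ, Fin.sum_univ_three] at hs
  have a0 := hle 0
  have a1 := hle 1
  have a2 := hle 2
  have hL : ∀ i, (L i).index = 3 := by
    intro i
    apply heq
    fin_cases i <;> simp only [Fin.zero_eta, Fin.mk_one, Fin.reduceFinMk] <;> linarith
  have h3 : ∀ i (p : ℤ × ℤ), 3 • p ∈ L i := fun i p => by
    have := (L i).nsmul_index_mem p
    rwa [hL i] at this
  have hcov2 : ⋃ i ∈ (Finset.univ : Finset (Fin 3)),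
      (0 : ℤ × ℤ) +ᵥ (L i : Set (ℤ × ℤ)) = Set.univ := by
    refine Set.eq_univ_of_forall fun p => ?_
    simp only [Finset.mem_univ, Set.iUnion_true, Set.mem_iUnion, zero_vadd, SetLike.mem_coe]
    by_cases hp : p ∈ evenLat
    · have hq : p + 3 • ((1, 0) : ℤ × ℤ) ∉ evenLat := by
        rw [mem_evenLat] at *
        simp
        omega
      obtain ⟨i, hi⟩ := hc _ hq
      exact ⟨i, ((L i).add_mem_cancel_right (h3 i _)).mp hi⟩
    · exact hc p hp
  classical
  have hd := AddSubgroup.pairwiseDisjoint_leftCoset_cover_of_sum_neg_index_eq_zero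
    (g := fun _ => 0) hcov2 (by simp [hL])
  have hf : ∀ i, (L i).FiniteIndex := fun i => ⟨by rw [hL i]; norm_num⟩
  have := hd (x := 0) (by simp [hf]) (y := 1) (by simp [hf]) (by decide)
  exact Set.disjoint_left.mp this (show (0 : ℤ × ℤ) ∈ _ by simp) (by simp)

/-- If `D ∈ {2,4}` and the four lattices `Λ₀, Λ₁, Λ₂, Λ₃` cover ℤ² with none of
them equal to ℤ², then one of `Λ₁, Λ₂, Λ₃` has index 2 in ℤ². -/
theorem lattice_covering_stmt (D ν t1 t2 t3 t4 : ℤ)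
    (hD : 0 < D) (hν : 0 < ν) (hdvd : D ∣ ν) (hle : ν ≤ D ^ 2) (hgt : 1 < D * ν)
    (hD24 : D = 2 ∨ D = 4)
    (hgcd : Int.gcd (Int.gcd (Int.gcd t1 t2) t3) t4 = 1)
    (hd2 : t1 * t4 - t2 * t3 ≠ 0)
    (hcover : ∀ p : ℤ × ℤ, p ∈ Lam0 D ν ∨ p ∈ Lam1 D ν t1 t2 t3 t4 ∨
      p ∈ Lam2 D ν t1 t2 t3 t4 ∨ p ∈ Lam3 D ν t1 t2 t3 t4)
    (hproper : Lam0 D ν ≠ ⊤ ∧ Lam1 D ν t1 t2 t3 t4 ≠ ⊤ ∧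
      Lam2 D ν t1 t2 t3 t4 ≠ ⊤ ∧ Lam3 D ν t1 t2 t3 t4 ≠ ⊤) :
    (Lam1 D ν t1 t2 t3 t4).index = 2 ∨
      (Lam2 D ν t1 t2 t3 t4).index = 2 ∨ (Lam3 D ν t1 t2 t3 t4).index = 2 := by
  by_contra! hne
  obtain ⟨-, p1, p2, p3⟩ := hproper
  refine cover_odd ![Lam1 D ν t1 t2 t3 t4, Lam2 D ν t1 t2 t3 t4, Lam3 D ν t1 t2 t3 t4] ?_ ?_ ?_
  · intro i
    fin_cases i
    exacts [p1, p2, p3]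
  · intro i
    fin_cases i
    exacts [hne.1, hne.2.1, hne.2.2]
  · intro p hp
    rcases hcover p with h | h | h | h
    · exfalso
      apply hp
      rw [mem_evenLat]
      have h' : D ∣ 1 * p.1 + 0 * p.2 := h.1
      have h2 : (2 : ℤ) ∣ D := by rcases hD24 with rfl | rfl <;> norm_num
      simpa using h2.trans h'
    · exact ⟨0, h⟩
    · exact ⟨1, h⟩
    · exact ⟨2, h⟩
end
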